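/- Let Ω ⊆ ℝⁿ be a region, A ⊆ closure(Ω) a countably rectifiable set, ν a measurable field of unit normals to A, and f a BV-similar function on Ω. Then the trace f^ν is μ-measurable on ∂^ν_A Ω, and μ({x ∈ ∂^ν_A Ω : f^ν(x) ≥ t}) = μ(∂^ν_A E_t) for almost all t ∈ ℝ. -/

import Mathlib

open MeasureTheory Metric Set Filter
open scoped ENNReal NNReal Topology RealInnerProductSpace

noncomputable section

/-- Euclidean space `ℝⁿ`. -/
abbrev Euc (n : ℕ) := EuclideanSpace ℝ (Fin n)

/-- The `(n-1)`-dimensional Hausdorff measure `μ` on `ℝⁿ`. -/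
def hm (n : ℕ) : Measure (Euc n) := μH[(n : ℝ) - 1]

/-- Divergence of a vector field on `ℝⁿ`. -/
def vdiv {n : ℕ} (φ : Euc n → Euc n) (x : Euc n) : ℝ :=
  ∑ i, ⟪fderiv ℝ φ x (EuclideanSpace.single i 1), EuclideanSpace.single i 1⟫

/-- The `BV` norm (variation of the gradient) of `f` on an open set `Ω`:
`‖f‖_{BV(Ω)} = sup { ∫_Ω f div φ : φ ∈ C¹_c(Ω, ℝⁿ), |φ| ≤ 1 }`. -/
def bvNorm {n : ℕ} (Ω : Set (Euc n)) (f : Euc n → ℝ) : ℝ≥0∞ :=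
  ⨆ (φ : Euc n → Euc n) (_ : ContDiff ℝ 1 φ) (_ : HasCompactSupport φ)
    (_ : tsupport φ ⊆ Ω) (_ : ∀ x, ‖φ x‖ ≤ 1),
    ENNReal.ofReal (∫ x in Ω, f x * vdiv φ x)

/-- The perimeter `P_Ω(E)` of `E` relative to `Ω`. -/
def perim {n : ℕ} (Ω E : Set (Euc n)) : ℝ≥0∞ :=
  bvNorm Ω (E.indicator fun _ => (1 : ℝ))

/-- `f ∈ BV(Ω)`: locally summable in `Ω`, the gradient being a (finite) vector charge. -/
def MemBV {n : ℕ} (Ω : Set (Euc n)) (f : Euc n → ℝ) : Prop :=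
  LocallyIntegrableOn f Ω volume ∧ bvNorm Ω f < ⊤

/-- The half ball `B^ν_x(r)`. -/
def halfBall {n : ℕ} (x ν : Euc n) (r : ℝ) : Set (Euc n) :=
  ball x r ∩ {y | 0 ≤ ⟪y - x, ν⟫}

/-- Volume of the unit ball in `ℝⁿ`. -/
def ubv (n : ℕ) : ℝ := (volume (ball (0 : Euc n) 1)).toReal

/-- `Θ^ν_E(x) = d`: the one-sided density of `E` at `x` with respect to `ν` equals `d`. -/
def HasOneSidedDensity {n : ℕ} (E : Set (Euc n)) (x ν : Euc n) (d : ℝ) : Prop :=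
  Tendsto (fun r : ℝ => 2 * (volume (halfBall x ν r ∩ E)).toReal / (ubv n * r ^ n))
    (𝓝[>] 0) (𝓝 d)

/-- `ν` is a (unit) normal to `A` at `x`: the hyperplane orthogonal to `ν` is an
approximate tangent plane of `A` at `x`. -/
def IsNormalAt {n : ℕ} (A : Set (Euc n)) (x ν : Euc n) : Prop :=
  ‖ν‖ = 1 ∧ ∀ ε > (0 : ℝ),
    Tendsto (fun r : ℝ =>
        (hm n ((A ∩ ball x r) \ {y | |⟪y - x, ν⟫| ≤ ε * r})).toReal / r ^ (n - 1))
      (𝓝[>] 0) (𝓝 0)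

/-- A regular point of `A`: a point where an approximate tangent plane (hence a normal)
exists and `A` has `(n-1)`-density one. -/
def RegularPoint {n : ℕ} (A : Set (Euc n)) (x : Euc n) : Prop :=
  (∃ ν, IsNormalAt A x ν) ∧
    Tendsto (fun r : ℝ => (hm n (A ∩ ball x r)).toReal / (ubv (n - 1) * r ^ (n - 1)))
      (𝓝[>] 0) (𝓝 1)

/-- `A ⊆ ℝⁿ` is countably `(n-1)`-rectifiable. -/
def CountablyRectifiable {n : ℕ} (A : Set (Euc n)) : Prop :=
  MeasurableSet A ∧
    ∃ g : ℕ → Euc (n - 1) → Euc n,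
      (∀ i, ContDiff ℝ 1 (g i)) ∧ hm n (A \ ⋃ i, range (g i)) = 0

/-- A measurable field of unit normals to `A`. -/
def NormalField {n : ℕ} (A : Set (Euc n)) (ν : Euc n → Euc n) : Prop :=
  Measurable ν ∧ (∀ x, ‖ν x‖ = 1) ∧
    ∀ᵐ x ∂(hm n).restrict A, RegularPoint A x → IsNormalAt A x (ν x)

/-- `ν` is the normal to `E` at `x` in the sense of Federer. -/
def IsFedererNormal {n : ℕ} (E : Set (Euc n)) (x ν : Euc n) : Prop :=
  ‖ν‖ = 1 ∧ HasOneSidedDensity E x (-ν) 1 ∧ HasOneSidedDensity E x ν 0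

/-- The reduced boundary `∂*E`: points where a Federer normal exists. -/
def redBdry {n : ℕ} (E : Set (Euc n)) : Set (Euc n) := {x | ∃ ν, IsFedererNormal E x ν}

/-- `Γ`: points of `∂Ω` where `Ω` has one-sided density one for at least one normal. -/
def Gamma {n : ℕ} (Ω : Set (Euc n)) : Set (Euc n) :=
  {x ∈ frontier Ω | ∃ ν, IsNormalAt (frontier Ω) x ν ∧ HasOneSidedDensity Ω x ν 1}

/-- `∂^ν_A E`, for a field `ν` of normals. -/
def nuBdry {n : ℕ} (A : Set (Euc n)) (ν : Euc n → Euc n) (E : Set (Euc n)) : Set (Euc n) :=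
  {x ∈ A | HasOneSidedDensity E x (ν x) 1}

/-- `∂²_A E = ∂^ν_A E ∩ ∂^{-ν}_A E`. -/
def bothBdry {n : ℕ} (A : Set (Euc n)) (ν : Euc n → Euc n) (E : Set (Euc n)) : Set (Euc n) :=
  nuBdry A ν E ∩ nuBdry A (fun x => -ν x) E

/-- The level set `E_t = {x ∈ Ω : f x > t}`. -/
def levelSet {n : ℕ} (Ω : Set (Euc n)) (f : Euc n → ℝ) (t : ℝ) : Set (Euc n) :=
  {x ∈ Ω | t < f x}

/-- `f` is `BV`-similar on `Ω`: almost all level sets have finite perimeter. -/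
def BVSimilar {n : ℕ} (Ω : Set (Euc n)) (f : Euc n → ℝ) : Prop :=
  ∀ᵐ t : ℝ, perim univ (levelSet Ω f t) < ⊤

/-- The (rough) trace `f^ν(x) = sup {t : x ∈ ∂^ν_A E_t}` (with `sup ∅ = -∞`). -/
def trace {n : ℕ} (Ω A : Set (Euc n)) (ν : Euc n → Euc n) (f : Euc n → ℝ) (x : Euc n) :
    EReal :=
  sSup ((fun t : ℝ => (t : EReal)) '' {t : ℝ | x ∈ nuBdry A ν (levelSet Ω f t)})

/-- The upper trace `f* = max (f^ν, f^{-ν})` on the boundary of `Ω`. -/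
def upperTrace {n : ℕ} (Ω : Set (Euc n)) (ν : Euc n → Euc n) (f : Euc n → ℝ) (x : Euc n) :
    EReal :=
  max (trace Ω (frontier Ω) ν f x) (trace Ω (frontier Ω) (fun y => -ν y) f x)

/-- The lower trace `f_* = min (f^ν, f^{-ν})` on the boundary of `Ω`. -/
def lowerTrace {n : ℕ} (Ω : Set (Euc n)) (ν : Euc n → Euc n) (f : Euc n → ℝ) (x : Euc n) :
    EReal :=
  min (trace Ω (frontier Ω) ν f x) (trace Ω (frontier Ω) (fun y => -ν y) f x)

/-- The canonical map `EReal → ℝ≥0∞` (negative values to `0`). -/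
def erealToENNReal (a : EReal) : ℝ≥0∞ := if a = ⊤ then ⊤ else ENNReal.ofReal a.toReal

/-- The norm `‖f‖_tr` of the trace of `f` on `∂Ω`:
`∫_{∂*Ω} |f*| dμ + ∫_{∂²_Γ Ω} (f* - f_*) dμ`. -/
def traceNorm {n : ℕ} (Ω : Set (Euc n)) (ν : Euc n → Euc n) (f : Euc n → ℝ) : ℝ≥0∞ :=
  (∫⁻ x in redBdry Ω, (upperTrace Ω ν f x).abs ∂hm n) +
    ∫⁻ x in bothBdry (frontier Ω) ν Ω,
      erealToENNReal (upperTrace Ω ν f x - lowerTrace Ω ν f x) ∂hm n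

/-- A region: a nonempty open connected subset of `ℝⁿ`. -/
def IsRegion {n : ℕ} (Ω : Set (Euc n)) : Prop := IsOpen Ω ∧ IsConnected Ω

/-- `τ_A`: the infimum of constants `β` such that `μ(∂*E ∩ Γ) ≤ β μ(∂*E ∩ Ω)` for all
`E ⊆ Ω` with `Vol(A ∩ E) + μ(A ∩ ∂*E) = 0`. -/
def tau {n : ℕ} (Ω A : Set (Euc n)) : ℝ≥0∞ :=
  sInf {β : ℝ≥0∞ | ∀ E : Set (Euc n), E ⊆ Ω → MeasurableSet E →
    volume (A ∩ E) = 0 → hm n (A ∩ redBdry E) = 0 →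
    hm n (redBdry E ∩ Gamma Ω) ≤ β * hm n (redBdry E ∩ Ω)}

/-- Canonical monotone extension of `φ : ℝ → ℝ` to `EReal`, sending `-∞` to `inf φ`
and `+∞` to `sup φ`. -/
def erealExt (φ : ℝ → ℝ) (a : EReal) : EReal :=
  if a = ⊥ then sInf (Set.range fun t : ℝ => (φ t : EReal))
  else if a = ⊤ then sSup (Set.range fun t : ℝ => (φ t : EReal))
  else (φ a.toReal : EReal)

/-- Integral of a function against a signed measure (a charge). -/
def sint {n : ℕ} (σ : SignedMeasure (Euc n)) (g : Euc n → ℝ) : ℝ :=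
  ∫ x, g x ∂σ.toJordanDecomposition.posPart - ∫ x, g x ∂σ.toJordanDecomposition.negPart

/-- `σ` is the vector charge `grad f` on `Ω` (componentwise), characterized by
integration by parts against test functions compactly supported in `Ω`. -/
def IsGradCharge {n : ℕ} (Ω : Set (Euc n)) (f : Euc n → ℝ)
    (σ : Fin n → SignedMeasure (Euc n)) : Prop :=
  ∀ φ : Euc n → ℝ, ContDiff ℝ 1 φ → HasCompactSupport φ → tsupport φ ⊆ Ω →
    ∀ i : Fin n,
      ∫ x in Ω, f x * fderiv ℝ φ x (EuclideanSpace.single i 1) = -sint (σ i) φ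

/-- A standard field of unit normals to `∂Ω`: a measurable field of unit normals that at
points of the reduced boundary `∂*Ω` is directed opposite to the Federer normal. -/
def StandardField {n : ℕ} (Ω : Set (Euc n)) (ν : Euc n → Euc n) : Prop :=
  NormalField (frontier Ω) ν ∧
    ∀ x ∈ redBdry Ω, ∀ w : Euc n, IsFedererNormal Ω x w → ν x = -w

lemma measurableSet_halfBall {n : ℕ} (x ν : Euc n) (r : ℝ) : MeasurableSet (halfBall x ν r) :=
  measurableSet_ball.inter
    (isClosed_le continuous_const (by fun_prop : Continuous fun y => ⟪y - x, ν⟫)).measurableSet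

lemma volume_halfBall_inter_ne_top {n : ℕ} (x ν : Euc n) (r : ℝ) (E : Set (Euc n)) :
    volume (halfBall x ν r ∩ E) ≠ ⊤ :=
  measure_ne_top_of_subset (inter_subset_left.trans inter_subset_left) measure_ball_lt_top.ne

lemma volume_halfBall_inter_toMeasurable {n : ℕ} (x ν : Euc n) (r : ℝ) (E : Set (Euc n)) :
    volume (halfBall x ν r ∩ toMeasurable volume E) = volume (halfBall x ν r ∩ E) := by
  rw [inter_comm, Measure.measure_toMeasurable_inter_of_sFinite (measurableSet_halfBall x ν r),
    inter_comm]

lemma hasOneSidedDensity_toMeasurable_iff {n : ℕ} (E : Set (Euc n)) (x ν : Euc n) (d : ℝ) :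
    HasOneSidedDensity (toMeasurable volume E) x ν d ↔ HasOneSidedDensity E x ν d := by
  simp only [HasOneSidedDensity, volume_halfBall_inter_toMeasurable]

lemma volume_hyperplane {n : ℕ} (x : Euc n) {ν : Euc n} (hν : ν ≠ 0) :
    volume {y : Euc n | ⟪y - x, ν⟫ = 0} = 0 := by
  have h : {y : Euc n | ⟪y - x, ν⟫ = 0} =
      (fun y => y + -x) ⁻¹' ((ℝ ∙ ν)ᗮ : Submodule ℝ (Euc n)) := by
    ext y
    simp [← sub_eq_add_neg, Submodule.mem_orthogonal_singleton_iff_inner_left]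
  rw [h, measure_preimage_add_right]
  refine Measure.addHaar_submodule _ _ fun hT => hν ?_
  have : ν ∈ (ℝ ∙ ν)ᗮ := hT ▸ Submodule.mem_top
  rwa [Submodule.mem_orthogonal_singleton_iff_inner_left, inner_self_eq_zero] at this

lemma two_mul_volume_halfBall {n : ℕ} (x : Euc n) {ν : Euc n} (hν : ν ≠ 0) (r : ℝ) :
    2 * volume (halfBall x ν r) = volume (ball x r) := by
  have hneg : volume (halfBall x (-ν) r) = volume (halfBall x ν r) := by
    have hmp : MeasurePreserving (fun y : Euc n => (x + x) - y) :=
      Measure.measurePreserving_sub_left volume (x + x)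
    rw [← hmp.measure_preimage (measurableSet_halfBall x ν r).nullMeasurableSet]
    congr 1
    ext y
    have h1 : x + x - y - x = -(y - x) := by abel
    simp only [halfBall, mem_inter_iff, mem_ball, mem_ofPred_eq, mem_preimage, dist_eq_norm, h1,
      norm_neg, inner_neg_left, inner_neg_right]
  have hU : halfBall x ν r ∪ halfBall x (-ν) r = ball x r := by
    ext y
    simp only [halfBall, mem_union, mem_inter_iff, mem_ofPred_eq, inner_neg_right]
    rcases le_total 0 ⟪y - x, ν⟫ with h | h <;> simp [h] <;> tauto
  have hI : volume (halfBall x ν r ∩ halfBall x (-ν) r) = 0 := by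
    refine measure_mono_null ?_ (volume_hyperplane x hν)
    rintro y ⟨⟨-, h1⟩, -, h2⟩
    simp only [mem_ofPred_eq, inner_neg_right] at h1 h2 ⊢
    linarith
  rw [← hU, ← add_zero (volume (_ ∪ _)), ← hI,
    measure_union_add_inter _ (measurableSet_halfBall x (-ν) r), hneg, two_mul]

/-- The quotient defining the one-sided density is at most `1`. -/
lemma oneSidedDensity_quotient_le_one {n : ℕ} (E : Set (Euc n)) (x : Euc n) {ν : Euc n}
    (hν : ν ≠ 0) {r : ℝ} (hr : 0 < r) :
    2 * (volume (halfBall x ν r ∩ E)).toReal / (ubv n * r ^ n) ≤ 1 := by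
  have : Nontrivial (Euc n) := ⟨ν, 0, hν⟩
  have hball : (volume (ball x r)).toReal = ubv n * r ^ n := by
    rw [Measure.addHaar_ball volume x hr.le, finrank_euclideanSpace_fin, ENNReal.toReal_mul,
      ENNReal.toReal_ofReal (by positivity), ubv, mul_comm]
  refine div_le_one_of_le₀ ?_ (hball ▸ ENNReal.toReal_nonneg)
  rw [← hball, ← two_mul_volume_halfBall x hν r, ENNReal.toReal_mul, ENNReal.toReal_ofNat]
  gcongr
  · exact measure_ne_top_of_subset inter_subset_left measure_ball_lt_top.ne
  · exact inter_subset_left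

lemma HasOneSidedDensity.mono {n : ℕ} {E F : Set (Euc n)} {x ν : Euc n} (hν : ν ≠ 0)
    (hE : HasOneSidedDensity E x ν 1) (hEF : E ⊆ F) : HasOneSidedDensity F x ν 1 := by
  refine tendsto_of_tendsto_of_tendsto_of_le_of_le' hE tendsto_const_nhds ?_ ?_
  · filter_upwards [self_mem_nhdsWithin] with r (hr : 0 < r)
    have : 0 ≤ ubv n * r ^ n := mul_nonneg ENNReal.toReal_nonneg (by positivity)
    gcongr
    exact volume_halfBall_inter_ne_top x ν r F
  · filter_upwards [self_mem_nhdsWithin] with r hr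
    exact oneSidedDensity_quotient_le_one F x hν hr

lemma nuBdry_mono {n : ℕ} {A : Set (Euc n)} {ν : Euc n → Euc n} (hν : ∀ x, ν x ≠ 0)
    {E F : Set (Euc n)} (hEF : E ⊆ F) : nuBdry A ν E ⊆ nuBdry A ν F :=
  fun x hx => ⟨hx.1, hx.2.mono (hν x) hEF⟩

lemma iUnion_halfBall {n : ℕ} (x ν : Euc n) {u : ℕ → ℝ} {r : ℝ} (hu : ∀ k, u k < r)
    (hur : Tendsto u atTop (𝓝 r)) : ⋃ k, halfBall x ν (u k) = halfBall x ν r := by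
  ext y
  simp only [mem_iUnion, halfBall, mem_inter_iff, mem_ball, exists_and_right]
  refine and_congr_left fun _ => ⟨fun ⟨k, hk⟩ => hk.trans (hu k), fun h => ?_⟩
  exact (hur.eventually_const_lt h).exists

/-- One-sided densities may be computed along rational radii. -/
lemma hasOneSidedDensity_iff_rat {n : ℕ} (E : Set (Euc n)) (x ν : Euc n) (d : ℝ) :
    HasOneSidedDensity E x ν d ↔
      Tendsto (fun q : ℚ => 2 * (volume (halfBall x ν q ∩ E)).toReal / (ubv n * (q : ℝ) ^ n))
        (comap ((↑) : ℚ → ℝ) (𝓝[>] 0)) (𝓝 d) := by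
  refine ⟨fun h => h.comp tendsto_comap, fun h => ?_⟩
  rw [← hasOneSidedDensity_toMeasurable_iff]
  simp only [← volume_halfBall_inter_toMeasurable x ν _ E] at h
  set F := toMeasurable volume E
  rw [Metric.tendsto_nhds] at h
  refine Metric.tendsto_nhds.2 fun ε hε => ?_
  have h1 := h (ε / 2) (by positivity)
  rw [eventually_comap, (nhdsGT_basis (0 : ℝ)).eventually_iff] at h1
  obtain ⟨δ, hδ, h1⟩ := h1
  filter_upwards [Ioo_mem_nhdsGT hδ] with r hr
  obtain ⟨u, hum, hur, hut⟩ := Real.exists_seq_rat_strictMono_tendsto r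
  have hmono : Monotone fun k => halfBall x ν (u k : ℝ) ∩ F := fun i j hij =>
    inter_subset_inter_left _ (inter_subset_inter_left _
      (ball_subset_ball (by exact_mod_cast hum.monotone hij)))
  have hlim : Tendsto (fun k => volume (halfBall x ν (u k : ℝ) ∩ F)) atTop
      (𝓝 (volume (halfBall x ν r ∩ F))) := by
    have := tendsto_measure_iUnion_atTop (μ := volume) hmono
    rwa [← iUnion_inter, iUnion_halfBall x ν hur hut] at this
  have hlim' : Tendsto (fun k => 2 * (volume (halfBall x ν (u k : ℝ) ∩ F)).toReal /
      (ubv n * (u k : ℝ) ^ n)) atTop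
      (𝓝 (2 * (volume (halfBall x ν r ∩ F)).toReal / (ubv n * r ^ n))) := by
    refine Tendsto.div (((ENNReal.tendsto_toReal
      (volume_halfBall_inter_ne_top x ν r F)).comp hlim).const_mul 2) ((hut.pow n).const_mul _) ?_
    exact mul_ne_zero (ENNReal.toReal_pos (measure_ball_pos _ _ one_pos).ne'
      measure_ball_lt_top.ne).ne' (pow_ne_zero _ hr.1.ne')
  refine (le_of_tendsto (hlim'.dist tendsto_const_nhds) ?_).trans_lt (half_lt_self hε)
  filter_upwards [hut.eventually_const_lt hr.1] with k hk
  exact (h1 ⟨hk, (hur k).trans hr.2⟩ (u k) rfl).le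

lemma measurable_volume_halfBall_inter {n : ℕ} {ν : Euc n → Euc n} (hν : Measurable ν)
    {E : Set (Euc n)} (hE : MeasurableSet E) (r : ℝ) :
    Measurable fun x => volume (halfBall x (ν x) r ∩ E) := by
  have hS : MeasurableSet {p : Euc n × Euc n | p.2 ∈ halfBall p.1 (ν p.1) r ∩ E} := by
    refine .inter (.inter ?_ ?_) (measurable_snd hE)
    · exact measurableSet_lt (measurable_snd.dist measurable_fst) measurable_const
    · exact measurableSet_le measurable_const
        ((measurable_snd.sub measurable_fst).inner (hν.comp measurable_fst))
  exact measurable_measure_prodMk_left hS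

/-- `∂^ν_A E` is a Borel set, even for non-measurable `E`. -/
lemma measurableSet_nuBdry {n : ℕ} {A : Set (Euc n)} (hA : MeasurableSet A)
    {ν : Euc n → Euc n} (hν : Measurable ν) (E : Set (Euc n)) :
    MeasurableSet (nuBdry A ν E) := by
  refine hA.inter (s₂ := {x | HasOneSidedDensity E x (ν x) 1}) ?_
  simp_rw [hasOneSidedDensity_iff_rat]
  refine measurableSet_tendsto _ fun q => ?_
  simp_rw [← volume_halfBall_inter_toMeasurable _ _ _ E]
  exact ((measurable_volume_halfBall_inter hν (measurableSet_toMeasurable _ E) q).ennreal_toReal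
    |>.const_mul 2).div_const _

lemma levelSet_anti {n : ℕ} (Ω : Set (Euc n)) (f : Euc n → ℝ) : Antitone (levelSet Ω f) :=
  fun _ _ hst _ hx => ⟨hx.1, hst.trans_lt hx.2⟩

lemma mem_nuBdry_of_lt_trace {n : ℕ} {Ω A : Set (Euc n)} {ν : Euc n → Euc n}
    (hν : ∀ x, ν x ≠ 0) {f : Euc n → ℝ} {x : Euc n} {t : ℝ} (h : (t : EReal) < trace Ω A ν f x) :
    x ∈ nuBdry A ν (levelSet Ω f t) := by
  obtain ⟨_, ⟨s, hs, rfl⟩, hts⟩ := lt_sSup_iff.1 h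
  exact nuBdry_mono hν (levelSet_anti Ω f (EReal.coe_lt_coe_iff.1 hts).le) hs

lemma le_trace_of_mem_nuBdry {n : ℕ} {Ω A : Set (Euc n)} {ν : Euc n → Euc n}
    {f : Euc n → ℝ} {x : Euc n} {t : ℝ} (h : x ∈ nuBdry A ν (levelSet Ω f t)) :
    (t : EReal) ≤ trace Ω A ν f x :=
  le_sSup ⟨t, h, rfl⟩

lemma measurable_trace {n : ℕ} (Ω : Set (Euc n)) {A : Set (Euc n)} (hA : MeasurableSet A)
    {ν : Euc n → Euc n} (hνm : Measurable ν) (hν : ∀ x, ν x ≠ 0) (f : Euc n → ℝ) :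
    Measurable (trace Ω A ν f) := by
  refine measurable_of_Ioi fun a => ?_
  have : trace Ω A ν f ⁻¹' Ioi a =
      ⋃ q : {q : ℚ // a < ((q : ℝ) : EReal)}, nuBdry A ν (levelSet Ω f (q : ℚ)) := by
    ext x
    simp only [mem_preimage, mem_Ioi, mem_iUnion]
    constructor
    · intro h
      obtain ⟨q, haq, hq⟩ := EReal.lt_iff_exists_rat_btwn.1 h
      exact ⟨⟨q, haq⟩, mem_nuBdry_of_lt_trace hν hq⟩
    · rintro ⟨q, hq⟩
      exact q.2.trans_le (le_trace_of_mem_nuBdry hq)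
  rw [this]
  exact .iUnion fun q => measurableSet_nuBdry hA hνm _

lemma hausdorffMeasure_image_closedBall_lt_top {m n : ℕ} {g : Euc m → Euc n}
    (hg : ContDiff ℝ 1 g) (R : ℝ) : μH[(m : ℝ)] (g '' closedBall 0 R) < ⊤ := by
  obtain ⟨K, hK⟩ := hg.locallyLipschitz.locallyLipschitzOn.exists_lipschitzOnWith_of_compact
    (isCompact_closedBall (0 : Euc m) R)
  refine (hK.hausdorffMeasure_image_le m.cast_nonneg).trans_lt (ENNReal.mul_lt_top
    (ENNReal.rpow_lt_top_of_nonneg m.cast_nonneg ENNReal.coe_ne_top) ?_)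
  have h : (μH[(m : ℝ)] : Measure (Euc m)) = μH[Module.finrank ℝ (Euc m)] := by
    rw [finrank_euclideanSpace_fin]
  rw [h]
  exact (isCompact_closedBall (0 : Euc m) R).measure_lt_top

lemma CountablyRectifiable.sigmaFinite {n : ℕ} (hn : 1 ≤ n) {A : Set (Euc n)}
    (hA : CountablyRectifiable A) : SigmaFinite ((hm n).restrict A) := by
  obtain ⟨hAm, g, hg, h0⟩ := hA
  have hfin (i k : ℕ) : hm n (g i '' closedBall 0 k) < ⊤ := by
    have := hausdorffMeasure_image_closedBall_lt_top (hg i) k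
    rwa [Nat.cast_sub hn, Nat.cast_one] at this
  refine Measure.sigmaFinite_of_countable
    (S := insert (⋃ i, range (g i))ᶜ (range fun p : ℕ × ℕ => g p.1 '' closedBall 0 p.2))
    ((countable_range _).insert _) ?_ ?_
  · rintro s (rfl | ⟨p, rfl⟩)
    · rw [Measure.restrict_apply' hAm, inter_comm, ← sdiff_eq, h0]
      exact ENNReal.zero_lt_top
    · exact (Measure.restrict_apply_le _ _).trans_lt (hfin _ _)
  · refine eq_univ_of_forall fun x => ?_
    by_cases hx : x ∈ ⋃ i, range (g i)
    · obtain ⟨i, y, rfl⟩ := mem_iUnion.1 hx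
      obtain ⟨k, hk⟩ := exists_nat_ge ‖y‖
      exact ⟨_, .inr ⟨(i, k), rfl⟩, y, by simpa using hk, rfl⟩
    · exact ⟨_, .inl rfl, hx⟩

/-- For a region `Ω`, a countably rectifiable `A ⊆ closure Ω`, a
measurable field `ν` of unit normals to `A` and a `BV`-similar function `f` on `Ω`,
the trace `f^ν` is `μ`-measurable on `∂^ν_A Ω` and
`μ {x ∈ ∂^ν_A Ω : f^ν(x) ≥ t} = μ (∂^ν_A E_t)` for almost all `t`. -/
theorem statement6 (n : ℕ) (Ω : Set (Euc n)) (hΩ : IsRegion Ω) (A : Set (Euc n))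
    (hA : CountablyRectifiable A) (hAΩ : A ⊆ closure Ω) (ν : Euc n → Euc n)
    (hν : NormalField A ν) (f : Euc n → ℝ) (hf : BVSimilar Ω f) :
    AEMeasurable (trace Ω A ν f) ((hm n).restrict (nuBdry A ν Ω)) ∧
      ∀ᵐ t : ℝ,
        hm n {x ∈ nuBdry A ν Ω | (t : EReal) ≤ trace Ω A ν f x} =
          hm n (nuBdry A ν (levelSet Ω f t)) := by
  obtain ⟨hνm, hν1, -⟩ := hν
  have hν0 (x : Euc n) : ν x ≠ 0 := fun h => by simpa [h] using hν1 x
  have hn : 1 ≤ n := by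
    rcases n.eq_zero_or_pos with rfl | hn
    · exact absurd (Subsingleton.elim _ _) (hν0 0)
    · exact hn
  have hmeas := measurable_trace Ω hA.1 hνm hν0 f
  refine ⟨hmeas.aemeasurable, ?_⟩
  have := hA.sigmaFinite hn
  have hcount := (Measure.countable_meas_level_set_pos (μ := (hm n).restrict A) hmeas).preimage
    EReal.coe_injective
  filter_upwards [hcount.ae_notMem volume] with t ht
  have hnull : hm n ({x | trace Ω A ν f x = t} ∩ A) = 0 := by
    rw [← Measure.restrict_apply' hA.1]
    simpa using ht
  refine le_antisymm ?_ (measure_mono fun x hx =>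
    ⟨nuBdry_mono hν0 (fun _ hy => hy.1) hx, le_trace_of_mem_nuBdry hx⟩)
  calc _ ≤ hm n (nuBdry A ν (levelSet Ω f t) ∪ {x | trace Ω A ν f x = t} ∩ A) := by
        refine measure_mono fun x ⟨hxΩ, hxt⟩ => ?_
        rcases hxt.lt_or_eq with h | h
        · exact .inl (mem_nuBdry_of_lt_trace hν0 h)
        · exact .inr ⟨h.symm, hxΩ.1⟩
    _ ≤ _ := (measure_union_le _ _).trans (by rw [hnull, add_zero])

end
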